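/- (Almost orthogonality of composed dyadic kernels.) Let A > 0 and let k, l ∈ ℤ. Let D₁, D₂ : ℝ^N × ℝ^N → ℝ be measurable kernels such that, for i = 1 at scale k and i = 2 at scale l (writing m for the corresponding scale): D_i(x,y) = 0 whenever d(x,y) ≥ 2^{3-m}; |D_i(x,y)| ≤ A 2^{mN}; |D_i(x,z) − D_i(y,z)| ≤ A 2^{mN} · 2^m d(x,y) and |D_i(z,x) − D_i(z,y)| ≤ A 2^{mN} · 2^m d(x,y) for all x, y, z; and ∫ D_i(x,z) dz = 0 = ∫ D_i(z,y) dz for all x, y. Then for every 0 < ε' < 1 there is a constant C, depending only on N, ε', A and the cardinality |G| of G, such that for all x, y ∈ ℝ^N: |∫_{ℝ^N} D₁(x,z) D₂(z,y) dz| ≤ C · 2^{-|k−l| ε'} · 2^{-(k∧l)} / (2^{-(k∧l)} + d(x,y))^{N+1}, where k∧l := min(k,l). -/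

import Mathlib

open MeasureTheory ENNReal

abbrev Euc (N : ℕ) := EuclideanSpace ℝ (Fin N)

abbrev OrthG (N : ℕ) := Euc N ≃ₗᵢ[ℝ] Euc N

/-- `d(x,y) := min_{σ ∈ G} ‖x - σ(y)‖`. -/
noncomputable def refDist {N : ℕ} (G : Subgroup (OrthG N)) (x y : Euc N) : ℝ :=
  sInf {r : ℝ | ∃ σ ∈ G, r = ‖x - σ y‖}


/-- A dyadic kernel at scale `m` with constant `A`: supported where `d(x,y) < 2^{3-m}`,
bounded by `A 2^{mN}`, Lipschitz in each variable at scale `2^m`, with cancellation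
in each variable. -/
def DyadicKernel {N : ℕ} (G : Subgroup (OrthG N)) (A : ℝ) (m : ℤ)
    (D : Euc N → Euc N → ℝ) : Prop :=
  Measurable (Function.uncurry D) ∧
  (∀ x y : Euc N, (2:ℝ) ^ (3 - m) ≤ refDist G x y → D x y = 0) ∧
  (∀ x y : Euc N, |D x y| ≤ A * (2:ℝ) ^ (m * (N : ℤ))) ∧
  (∀ x y z : Euc N,
    |D x z - D y z| ≤ A * (2:ℝ) ^ (m * (N : ℤ)) * ((2:ℝ) ^ m * refDist G x y)) ∧
  (∀ x y z : Euc N,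
    |D z x - D z y| ≤ A * (2:ℝ) ^ (m * (N : ℤ)) * ((2:ℝ) ^ m * refDist G x y)) ∧
  (∀ x : Euc N, (∫ z : Euc N, D x z) = 0) ∧
  (∀ y : Euc N, (∫ z : Euc N, D z y) = 0)

section RefDist

variable {N : ℕ} (G : Subgroup (OrthG N))

lemma refDist_le {σ : OrthG N} (hσ : σ ∈ G) (x y : Euc N) : refDist G x y ≤ ‖x - σ y‖ :=
  csInf_le ⟨0, by rintro r ⟨τ, -, rfl⟩; exact norm_nonneg _⟩ ⟨σ, hσ, rfl⟩

lemma exists_refDist_eq [Finite G] (x y : Euc N) : ∃ σ ∈ G, refDist G x y = ‖x - σ y‖ := by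
  have hne : {r : ℝ | ∃ σ ∈ G, r = ‖x - σ y‖}.Nonempty := ⟨_, 1, G.one_mem, rfl⟩
  have hfin : {r : ℝ | ∃ σ ∈ G, r = ‖x - σ y‖}.Finite := by
    refine (Set.finite_range fun σ : G => ‖x - (σ : OrthG N) y‖).subset ?_
    rintro r ⟨σ, hσ, rfl⟩
    exact ⟨⟨σ, hσ⟩, rfl⟩
  exact hne.csInf_mem hfin

lemma refDist_nonneg (x y : Euc N) : 0 ≤ refDist G x y :=
  Real.sInf_nonneg (by rintro r ⟨τ, -, rfl⟩; exact norm_nonneg _)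

lemma refDist_comm_le [Finite G] (x y : Euc N) : refDist G x y ≤ refDist G y x := by
  obtain ⟨σ, hσ, h⟩ := exists_refDist_eq G y x
  rw [h]
  refine (refDist_le G (G.inv_mem hσ) x y).trans_eq ?_
  rw [← (σ⁻¹).norm_map (y - σ x), map_sub, norm_sub_rev]
  congr 2
  exact (σ.symm_apply_apply x).symm

lemma refDist_comm [Finite G] (x y : Euc N) : refDist G x y = refDist G y x :=
  le_antisymm (refDist_comm_le G x y) (refDist_comm_le G y x)

lemma refDist_triangle [Finite G] (x y z : Euc N) :
    refDist G x z ≤ refDist G x y + refDist G y z := by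
  obtain ⟨σ, hσ, h⟩ := exists_refDist_eq G x y
  obtain ⟨τ, hτ, h'⟩ := exists_refDist_eq G y z
  rw [h, h', ← σ.norm_map (y - τ z), map_sub]
  refine (refDist_le G (G.mul_mem hσ hτ) x z).trans ?_
  exact norm_sub_le_norm_sub_add_norm_sub _ _ _

/-- The orbit neighbourhood of radius `r` around `y`, as a union of balls. -/
def orbitBall (y : Euc N) (r : ℝ) : Set (Euc N) := ⋃ σ : G, Metric.ball ((σ : OrthG N) y) r

lemma mem_orbitBall [Finite G] {y z : Euc N} {r : ℝ} :
    z ∈ orbitBall G y r ↔ refDist G z y < r := by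
  simp only [orbitBall, Set.mem_iUnion, Metric.mem_ball, dist_eq_norm]
  constructor
  · rintro ⟨σ, h⟩
    exact (refDist_le G σ.2 z y).trans_lt h
  · intro h
    obtain ⟨σ, hσ, e⟩ := exists_refDist_eq G z y
    exact ⟨⟨σ, hσ⟩, e ▸ h⟩

lemma volume_orbitBall_le [Finite G] (y : Euc N) {r : ℝ} (hr : 0 < r) :
    volume (orbitBall G y r) ≤
      ENNReal.ofReal (Nat.card G * (r ^ N * (volume (Metric.ball (0 : Euc N) 1)).toReal)) := by
  have := Fintype.ofFinite G
  refine (measure_iUnion_fintype_le _ _).trans_eq ?_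
  have h (σ : G) : volume (Metric.ball ((σ : OrthG N) y) r) =
      ENNReal.ofReal (r ^ N * (volume (Metric.ball (0 : Euc N) 1)).toReal) := by
    rw [Measure.addHaar_ball_of_pos _ _ hr, finrank_euclideanSpace_fin,
      ENNReal.ofReal_mul (by positivity), ENNReal.ofReal_toReal measure_ball_lt_top.ne]
  simp only [h, Finset.sum_const, Finset.card_univ, nsmul_eq_mul, Nat.card_eq_fintype_card]
  rw [ENNReal.ofReal_mul (Nat.cast_nonneg _), ENNReal.ofReal_natCast]

end RefDist

namespace DyadicKernel

variable {N : ℕ} {G : Subgroup (OrthG N)} {A : ℝ}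

lemma flip [Finite G] {m : ℤ} {D : Euc N → Euc N → ℝ} (h : DyadicKernel G A m D) :
    DyadicKernel G A m (fun x y => D y x) := by
  obtain ⟨hm, hs, hb, h₁, h₂, hi, hi'⟩ := h
  refine ⟨hm.comp measurable_swap, fun x y hxy => hs y x ?_, fun x y => hb y x, h₂, h₁, hi', hi⟩
  rwa [refDist_comm]

lemma integrable_left [Finite G] {m : ℤ} {D : Euc N → Euc N → ℝ} (h : DyadicKernel G A m D)
    (y : Euc N) : Integrable (fun z => D z y) := by
  obtain ⟨hm, hs, hb, -⟩ := h
  have hr : (0 : ℝ) < 2 ^ (3 - m) := by positivity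
  have hsupp : Function.support (fun z => D z y) ⊆ orbitBall G y (2 ^ (3 - m)) := by
    intro z hz
    rw [mem_orbitBall]
    by_contra! hc
    exact hz (hs z y hc)
  rw [← integrableOn_iff_integrable_of_support_subset hsupp]
  refine Measure.integrableOn_of_bounded (M := A * (2 : ℝ) ^ (m * (N : ℤ)))
    ((volume_orbitBall_le G y hr).trans_lt ENNReal.ofReal_lt_top).ne
    (hm.comp (measurable_id.prodMk measurable_const)).aestronglyMeasurable ?_
  exact .of_forall fun z => hb z y

/-- Composing with a finer kernel, the cancellation of the finer kernel against the Lipschitz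
regularity of the coarser one gains the ratio of the scales. -/
lemma abs_integral_mul_le [Finite G] (hA : 0 < A) {k l : ℤ} {D₁ D₂ : Euc N → Euc N → ℝ}
    (h₁ : DyadicKernel G A k D₁) (h₂ : DyadicKernel G A l D₂) (x y : Euc N) :
    |∫ z, D₁ x z * D₂ z y| ≤
      (A * 2 ^ (k * (N : ℤ)) * (2 ^ k * 2 ^ (3 - l)) * (A * 2 ^ (l * (N : ℤ)))) *
      (Nat.card G * ((2 ^ (3 - l)) ^ N * (volume (Metric.ball (0 : Euc N) 1)).toReal)) := by
  have hr : (0 : ℝ) < 2 ^ (3 - l) := by positivity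
  have hint := h₂.integrable_left y
  have hprod : Integrable (fun z => D₁ x z * D₂ z y) :=
    hint.bdd_mul (c := A * (2 : ℝ) ^ (k * (N : ℤ)))
      (h₁.1.comp (measurable_const.prodMk measurable_id)).aestronglyMeasurable
      (.of_forall fun z => h₁.2.2.1 x z)
  have hcancel : ∫ z, D₁ x z * D₂ z y = ∫ z, (D₁ x z - D₁ x y) * D₂ z y := by
    simp_rw [sub_mul]
    rw [integral_sub hprod (hint.const_mul _), integral_const_mul, h₂.2.2.2.2.2.2 y]
    simp
  have hvol := volume_orbitBall_le G y hr
  rw [hcancel, ← setIntegral_eq_integral_of_forall_compl_eq_zero (s := orbitBall G y (2 ^ (3 - l)))]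
  · rw [← Real.norm_eq_abs]
    refine (norm_setIntegral_le_of_norm_le_const (hvol.trans_lt ENNReal.ofReal_lt_top)
      (C := A * 2 ^ (k * (N : ℤ)) * (2 ^ k * 2 ^ (3 - l)) * (A * 2 ^ (l * (N : ℤ)))) ?_).trans ?_
    · intro z hz
      rw [mem_orbitBall] at hz
      rw [norm_mul]
      refine mul_le_mul ((h₁.2.2.2.2.1 z y x).trans ?_) (h₂.2.2.1 z y) (norm_nonneg _)
        (by positivity)
      gcongr
    · refine mul_le_mul_of_nonneg_left ?_ (by positivity)
      exact ENNReal.toReal_le_of_le_ofReal (by positivity) hvol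
  · intro z hz
    rw [mem_orbitBall, not_lt] at hz
    rw [h₂.2.1 z y hz, mul_zero]

lemma integral_mul_eq_zero [Finite G] {k l : ℤ} (hkl : k ≤ l) {D₁ D₂ : Euc N → Euc N → ℝ}
    (h₁ : DyadicKernel G A k D₁) (h₂ : DyadicKernel G A l D₂) {x y : Euc N}
    (hxy : (2 : ℝ) ^ (4 - k) ≤ refDist G x y) : ∫ z, D₁ x z * D₂ z y = 0 := by
  have h (z : Euc N) : D₁ x z * D₂ z y = 0 := by
    by_contra hne
    obtain ⟨n₁, n₂⟩ := mul_ne_zero_iff.mp hne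
    have d₁ : refDist G x z < 2 ^ (3 - k) := by
      by_contra! hc
      exact n₁ (h₁.2.1 x z hc)
    have d₂ : refDist G z y < 2 ^ (3 - l) := by
      by_contra! hc
      exact n₂ (h₂.2.1 z y hc)
    have hmono : (2 : ℝ) ^ (3 - l) ≤ 2 ^ (3 - k) := zpow_le_zpow_right₀ (by norm_num) (by omega)
    have htwo : (2 : ℝ) ^ (4 - k) = 2 ^ (3 - k) * 2 := by
      rw [← zpow_add_one₀ (by norm_num)]
      congr 1
      ring
    linarith [refDist_triangle G x z y]
  simp [h]

lemma abs_integral_mul_le_of_le [Finite G] (hA : 0 < A) {ε' : ℝ} (hε' : ε' < 1)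
    {k l : ℤ} (hkl : k ≤ l) {D₁ D₂ : Euc N → Euc N → ℝ}
    (h₁ : DyadicKernel G A k D₁) (h₂ : DyadicKernel G A l D₂) (x y : Euc N) :
    |∫ z, D₁ x z * D₂ z y| ≤
      (A ^ 2 * 8 ^ (N + 1) * (Nat.card G * (volume (Metric.ball (0 : Euc N) 1)).toReal) *
        17 ^ (N + 1)) * (2 : ℝ) ^ (-((l - k : ℤ) : ℝ) * ε') *
      ((2 : ℝ) ^ (-k) / ((2 : ℝ) ^ (-k) + refDist G x y) ^ (N + 1)) := by
  have hd := refDist_nonneg G x y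
  rcases le_or_gt ((2 : ℝ) ^ (4 - k)) (refDist G x y) with hfar | hnear
  · rw [integral_mul_eq_zero hkl h₁ h₂ hfar, abs_zero]
    positivity
  have ha : (0 : ℝ) < 2 ^ k := by positivity
  have hb : (0 : ℝ) < 2 ^ l := by positivity
  have hscale : (2 : ℝ) ^ k / 2 ^ l ≤ (2 : ℝ) ^ (-((l - k : ℤ) : ℝ) * ε') := by
    rw [← zpow_sub₀ (by norm_num), ← Real.rpow_intCast]
    refine Real.rpow_le_rpow_of_exponent_le (by norm_num) ?_
    have : (0 : ℝ) ≤ (l : ℝ) - k := by exact_mod_cast sub_nonneg.mpr hkl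
    push_cast
    nlinarith
  have hloc : ((2 : ℝ) ^ k) ^ N / 17 ^ (N + 1) ≤
      (2 : ℝ) ^ (-k) / ((2 : ℝ) ^ (-k) + refDist G x y) ^ (N + 1) := by
    have h4 : (2 : ℝ) ^ (4 - k) = 16 * 2 ^ (-k) := by
      rw [sub_eq_add_neg, zpow_add₀ (by norm_num)]
      norm_num
    have hle : (2 : ℝ) ^ (-k) + refDist G x y ≤ 17 * 2 ^ (-k) := by linarith
    calc ((2 : ℝ) ^ k) ^ N / 17 ^ (N + 1) = (2 : ℝ) ^ (-k) / (17 * 2 ^ (-k)) ^ (N + 1) := by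
          rw [zpow_neg, mul_pow, inv_pow]
          field_simp
          ring
      _ ≤ _ := by gcongr
  refine (h₁.abs_integral_mul_le hA h₂ x y).trans ?_
  calc _ = (A ^ 2 * 8 ^ (N + 1) * (Nat.card G * (volume (Metric.ball (0 : Euc N) 1)).toReal) *
        17 ^ (N + 1)) * ((2 : ℝ) ^ k / 2 ^ l) * (((2 : ℝ) ^ k) ^ N / 17 ^ (N + 1)) := by
        rw [zpow_mul, zpow_mul, zpow_natCast, zpow_natCast, zpow_sub₀ (by norm_num), div_pow]
        norm_num
        field_simp
        ring
    _ ≤ _ := by gcongr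

end DyadicKernel

/-- almost orthogonality of composed dyadic kernels. -/
theorem stmt_19 {N : ℕ} (hN : 1 ≤ N) (G : Subgroup (OrthG N)) [Finite G]
    (ε' : ℝ) (hε'0 : 0 < ε') (hε'1 : ε' < 1) (A : ℝ) (hA : 0 < A) :
    ∃ C : ℝ, 0 < C ∧
      ∀ (k l : ℤ) (D₁ D₂ : Euc N → Euc N → ℝ),
        DyadicKernel G A k D₁ → DyadicKernel G A l D₂ →
        ∀ x y : Euc N,
          |∫ z : Euc N, D₁ x z * D₂ z y|
            ≤ C * (2:ℝ) ^ (-((|k - l| : ℤ) : ℝ) * ε') *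
              ((2:ℝ) ^ (-(min k l)) /
                ((2:ℝ) ^ (-(min k l)) + refDist G x y) ^ (N + 1)) := by
  have hv : 0 < (volume (Metric.ball (0 : Euc N) 1)).toReal :=
    ENNReal.toReal_pos (Metric.measure_ball_pos _ _ one_pos).ne' measure_ball_lt_top.ne
  have hG : 0 < Nat.card G := Nat.card_pos
  refine ⟨A ^ 2 * 8 ^ (N + 1) * (Nat.card G * (volume (Metric.ball (0 : Euc N) 1)).toReal) *
    17 ^ (N + 1), by positivity, fun k l D₁ D₂ h₁ h₂ x y => ?_⟩
  rcases le_total k l with hkl | hlk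
  · rw [min_eq_left hkl, abs_sub_comm k l, abs_of_nonneg (sub_nonneg.mpr hkl)]
    exact h₁.abs_integral_mul_le_of_le hA hε'1 hkl h₂ x y
  · rw [min_eq_right hlk, abs_of_nonneg (sub_nonneg.mpr hlk), refDist_comm]
    simp_rw [mul_comm (D₁ x _)]
    exact h₂.flip.abs_integral_mul_le_of_le hA hε'1 hlk h₁.flip y x
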